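/- Let X ⊂ ℝ^d be a relatively separated set, s > d, and α = (α₁,…,α_d) ∈ ℕ₀^d. If a B(H)-valued matrix A = [A_{k,l}]_{k,l∈X} satisfies the anisotropic polynomial decay condition ‖A_{k,l}‖ ≤ C (1+|k−l|)^{−s} ∏_{j=1}^d (1+|k_j−l_j|)^{−α_j} for all k,l ∈ X and some C > 0, and the bounded operator on ℓ²(X;H) defined by A is invertible, then the canonical matrix representation [B_{k,l}]_{k,l∈X} of the inverse operator satisfies the same type of decay: there is C' > 0 with ‖B_{k,l}‖ ≤ C' (1+|k−l|)^{−s} ∏_{j=1}^d (1+|k_j−l_j|)^{−α_j} for all k,l ∈ X. -/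

import Mathlib

open scoped ENNReal
open Set

noncomputable section

/-- `ℝ^d` with the Euclidean norm. -/
abbrev Euc (d : ℕ) := EuclideanSpace ℝ (Fin d)

/-- A set `X ⊂ ℝ^d` is relatively separated if
`sup_{x ∈ ℝ^d} #(X ∩ (x + [0,1]^d)) < ∞`. -/
def RelSep {d : ℕ} (X : Set (Euc d)) : Prop :=
  ∃ N : ℕ, ∀ x : Euc d,
    (X ∩ {y | ∀ j, x j ≤ y j ∧ y j ≤ x j + 1}).Finite ∧
    (X ∩ {y | ∀ j, x j ≤ y j ∧ y j ≤ x j + 1}).ncard ≤ N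

/-- The sequence `δ_l f ∈ ℓ^p(X;H)` equal to `f` at index `l` and `0` elsewhere. -/
noncomputable def deltaSeq {X : Type*} {H : Type*} [NormedAddCommGroup H]
    (p : ℝ≥0∞) (l : X) (f : H) : lp (fun _ : X => H) p :=
  haveI := Classical.decEq X
  lp.single p l f

/-- If `T` has a left inverse, then `1 - c T* T` is a strict contraction for some `c`. -/
theorem exists_norm_id_sub_smul_adjoint_comp_le {E : Type*} [NormedAddCommGroup E]
    [InnerProductSpace ℂ E] [CompleteSpace E] (T S : E →L[ℂ] E) (hST : S.comp T = ContinuousLinearMap.id ℂ E) :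
    ∃ c q : ℝ, 0 < q ∧ q < 1 ∧
      ‖ContinuousLinearMap.id ℂ E - (c : ℂ) • (ContinuousLinearMap.adjoint T).comp T‖ ≤ q := by
  set t := ‖T‖ ^ 2 + 1 with ht
  set u := ‖S‖ ^ 2 + 1 with hu
  have ht0 : 1 ≤ t := by nlinarith [sq_nonneg ‖T‖]
  have hu0 : 1 ≤ u := by nlinarith [sq_nonneg ‖S‖]
  have htu : 1 ≤ t * u := one_le_mul_of_one_le_of_one_le ht0 hu0
  have hinv : (t * u)⁻¹ ≤ 1 := inv_le_one_of_one_le₀ htu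
  have hinv0 : 0 < (t * u)⁻¹ := by positivity
  have hq0 : 0 ≤ 1 - (t * u)⁻¹ / 2 := by linarith
  refine ⟨t⁻¹, √(1 - (t * u)⁻¹ / 2), Real.sqrt_pos.2 (by linarith), ?_, ?_⟩
  · rw [Real.sqrt_lt' one_pos]; linarith
  refine ContinuousLinearMap.opNorm_le_bound _ (Real.sqrt_nonneg _) fun x => ?_
  have hx : ‖x‖ ≤ ‖S‖ * ‖T x‖ := by
    have : S (T x) = x := by simpa using DFunLike.congr_fun hST x
    calc ‖x‖ = ‖S (T x)‖ := by rw [this]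
      _ ≤ _ := S.le_opNorm _
  have hx2 : ‖x‖ ^ 2 ≤ u * ‖T x‖ ^ 2 := by
    calc ‖x‖ ^ 2 ≤ (‖S‖ * ‖T x‖) ^ 2 := by gcongr
      _ = ‖S‖ ^ 2 * ‖T x‖ ^ 2 := by ring
      _ ≤ _ := by gcongr; linarith
  have hadj : ‖ContinuousLinearMap.adjoint T (T x)‖ ^ 2 ≤ t * ‖T x‖ ^ 2 := by
    calc ‖ContinuousLinearMap.adjoint T (T x)‖ ^ 2
          ≤ (‖ContinuousLinearMap.adjoint T‖ * ‖T x‖) ^ 2 := by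
            gcongr; exact ContinuousLinearMap.le_opNorm _ _
      _ = ‖T‖ ^ 2 * ‖T x‖ ^ 2 := by
            rw [LinearIsometryEquiv.norm_map]; ring
      _ ≤ _ := by gcongr; linarith
  have hexp : ‖x - ((t⁻¹ : ℝ) : ℂ) • ContinuousLinearMap.adjoint T (T x)‖ ^ 2
      = ‖x‖ ^ 2 - 2 * (t⁻¹ * ‖T x‖ ^ 2)
        + t⁻¹ ^ 2 * ‖ContinuousLinearMap.adjoint T (T x)‖ ^ 2 := by
    rw [@norm_sub_sq ℂ, inner_smul_right, ContinuousLinearMap.adjoint_inner_right, norm_smul,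
      inner_self_eq_norm_sq_to_K]
    have : ‖((t⁻¹ : ℝ) : ℂ)‖ = t⁻¹ := by
      rw [Complex.norm_real, Real.norm_of_nonneg (by positivity)]
    rw [this, mul_pow]
    congr 3
    rw [RCLike.re_eq_complex_re, Complex.re_ofReal_mul]
    congr 1
    norm_cast
  have hkey : ‖x - ((t⁻¹ : ℝ) : ℂ) • ContinuousLinearMap.adjoint T (T x)‖ ^ 2
      ≤ (1 - (t * u)⁻¹ / 2) * ‖x‖ ^ 2 := by
    rw [hexp]
    have h1 : t⁻¹ ^ 2 * ‖ContinuousLinearMap.adjoint T (T x)‖ ^ 2 ≤ t⁻¹ * ‖T x‖ ^ 2 := by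
      calc _ ≤ t⁻¹ ^ 2 * (t * ‖T x‖ ^ 2) := by gcongr
        _ = _ := by field_simp
    have h2 : (t * u)⁻¹ * ‖x‖ ^ 2 ≤ t⁻¹ * ‖T x‖ ^ 2 := by
      calc _ ≤ (t * u)⁻¹ * (u * ‖T x‖ ^ 2) := by gcongr
        _ = _ := by field_simp
    have h3 : 0 ≤ (t * u)⁻¹ * ‖x‖ ^ 2 := by positivity
    linarith
  have := Real.sqrt_le_sqrt hkey
  rw [Real.sqrt_sq (norm_nonneg _), Real.sqrt_mul hq0, Real.sqrt_sq (norm_nonneg _)] at this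
  simpa using this

/-- The row sums of `(1 + |k - m|) ^ (-r)` over a relatively separated set are uniformly bounded
when `r > d`. -/
theorem exists_sum_one_add_norm_sub_rpow_le {d : ℕ} (X : Set (Euc d)) (hX : RelSep X)
    (r : ℝ) (hr : (d : ℝ) < r) :
    ∃ K : ℝ, 0 < K ∧ ∀ (k : X) (F : Finset X),
      ∑ m ∈ F, (1 + ‖(k : Euc d) - (m : Euc d)‖) ^ (-r) ≤ K := by
  classical
  obtain ⟨N, hN⟩ := hX
  set b := (EuclideanSpace.basisFun (Fin d) ℝ).toBasis with hb
  set L := Submodule.span ℤ (Set.range b) with hL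
  have hr0 : 0 < r := lt_of_le_of_lt (Nat.cast_nonneg d) hr
  have hrank : Module.finrank ℤ L = d := by
    rw [ZLattice.rank ℝ L]; simp
  have hsum : Summable fun z : L => (1 + ‖z‖) ^ (-r) := by
    refine Summable.of_norm_bounded_eventually
      (ZLattice.summable_norm_rpow L (-r) (by rw [hrank]; linarith)) ?_
    filter_upwards [(Set.finite_singleton (0 : L)).compl_mem_cofinite] with z hz
    have hz : 0 < ‖z‖ := norm_pos_iff.2 hz
    rw [Real.norm_of_nonneg (by positivity)]
    exact Real.rpow_le_rpow_of_nonpos hz (by linarith) (by linarith)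
  have hfract : ∀ x : Euc d, ‖ZSpan.fract b x‖ ≤ d := fun x => by
    refine (ZSpan.norm_fract_le (K := ℝ) b x).trans ?_
    simp [hb]
  have hcard : ∀ (F : Finset X) (c : L),
      ((F.filter fun m : X => ZSpan.floor b (m : Euc d) = c).card : ℝ) ≤ N := fun F c => by
    have h := hN (c : Euc d)
    rw [← Finset.card_map (Function.Embedding.subtype (· ∈ X)), ← Set.ncard_coe_finset]
    refine Nat.cast_le.2 <| (Set.ncard_le_ncard ?_ h.1).trans h.2
    intro y hy
    simp only [Finset.coe_map, Function.Embedding.subtype_apply, Set.mem_image,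
      Finset.mem_coe, Finset.mem_filter] at hy
    obtain ⟨m, ⟨-, hm⟩, rfl⟩ := hy
    refine ⟨m.2, fun j => ?_⟩
    have h1 := ZSpan.repr_floor_apply (K := ℝ) b (m : Euc d) j
    rw [hm] at h1
    have h2 : ∀ y : Euc d, b.repr y j = y j := fun y => by simp [hb]
    rw [h2, h2] at h1
    rw [h1]
    exact ⟨Int.floor_le _, (Int.lt_floor_add_one _).le⟩
  refine ⟨(1 + 2 * (d : ℝ)) ^ r * (N * ∑' z : L, (1 + ‖z‖) ^ (-r)) + 1, by positivity,
    fun k F => ?_⟩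
  have hterm : ∀ m : X, (1 + ‖(k : Euc d) - (m : Euc d)‖) ^ (-r) ≤
      (1 + 2 * (d : ℝ)) ^ r *
        (1 + ‖ZSpan.floor b (m : Euc d) - ZSpan.floor b (k : Euc d)‖) ^ (-r) := fun m => by
    have h1 : ‖ZSpan.floor b (m : Euc d) - ZSpan.floor b (k : Euc d)‖ ≤
        ‖(k : Euc d) - (m : Euc d)‖ + 2 * d := by
      have : ((ZSpan.floor b (m : Euc d) - ZSpan.floor b (k : Euc d) : L) : Euc d) =
          ((m : Euc d) - k) - ZSpan.fract b (m : Euc d) + ZSpan.fract b (k : Euc d) := by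
        simp only [ZSpan.fract_apply, Submodule.coe_sub]; abel
      rw [← Submodule.norm_coe, this, norm_sub_rev (k : Euc d)]
      refine (norm_add_le _ _).trans ?_
      have := norm_sub_le ((m : Euc d) - k) (ZSpan.fract b (m : Euc d))
      linarith [hfract (m : Euc d), hfract (k : Euc d)]
    rw [Real.rpow_neg (by positivity), Real.rpow_neg (by positivity), ← div_eq_mul_inv,
      ← one_div, div_le_div_iff₀ (by positivity) (by positivity), one_mul,
      ← Real.mul_rpow (by positivity) (by positivity)]
    refine Real.rpow_le_rpow (by positivity) ?_ hr0.le
    have := mul_nonneg (Nat.cast_nonneg (α := ℝ) d) (norm_nonneg ((k : Euc d) - (m : Euc d)))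
    nlinarith
  calc ∑ m ∈ F, (1 + ‖(k : Euc d) - (m : Euc d)‖) ^ (-r)
      ≤ ∑ m ∈ F, (1 + 2 * (d : ℝ)) ^ r *
        (1 + ‖ZSpan.floor b (m : Euc d) - ZSpan.floor b (k : Euc d)‖) ^ (-r) :=
        Finset.sum_le_sum fun m _ => hterm m
    _ = (1 + 2 * (d : ℝ)) ^ r * ∑ c ∈ F.image fun m : X => ZSpan.floor b (m : Euc d),
          ((F.filter fun m : X => ZSpan.floor b (m : Euc d) = c).card : ℝ) *
            (1 + ‖c - ZSpan.floor b (k : Euc d)‖) ^ (-r) := by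
        rw [← Finset.mul_sum, Finset.sum_comp
          (fun c : L => (1 + ‖c - ZSpan.floor b (k : Euc d)‖) ^ (-r))
          fun m : X => ZSpan.floor b (m : Euc d)]
        simp only [nsmul_eq_mul]
        congr!
    _ ≤ (1 + 2 * (d : ℝ)) ^ r * ∑ c ∈ F.image fun m : X => ZSpan.floor b (m : Euc d),
          (N : ℝ) * (1 + ‖c - ZSpan.floor b (k : Euc d)‖) ^ (-r) := by
        gcongr with c hc
        exact_mod_cast hcard F c
    _ ≤ (1 + 2 * (d : ℝ)) ^ r * (N * ∑' z : L, (1 + ‖z‖) ^ (-r)) := by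
        rw [← Finset.mul_sum]
        gcongr
        rw [← (Equiv.subRight (ZSpan.floor b (k : Euc d))).tsum_eq]
        exact ((Equiv.subRight (ZSpan.floor b (k : Euc d))).summable_iff.2 hsum).sum_le_tsum _
          fun _ _ => Real.rpow_nonneg (by positivity) _
    _ ≤ _ := by linarith

theorem deltaSeq_apply_self {ι H : Type*} [NormedAddCommGroup H] (l : ι) (f : H) :
    deltaSeq 2 l f l = f :=
  letI := Classical.decEq ι
  lp.single_apply_self (E := fun _ : ι => H) 2 l f

theorem deltaSeq_apply_ne {ι H : Type*} [NormedAddCommGroup H] {k l : ι} (f : H) (h : k ≠ l) :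
    deltaSeq 2 l f k = 0 :=
  letI := Classical.decEq ι
  lp.single_apply_ne (E := fun _ : ι => H) 2 l f h

theorem norm_deltaSeq {ι H : Type*} [NormedAddCommGroup H] (l : ι) (f : H) :
    ‖deltaSeq 2 l f‖ = ‖f‖ :=
  letI := Classical.decEq ι
  lp.norm_single (E := fun _ : ι => H) (p := 2) (by norm_num) l f

theorem hasSum_deltaSeq {ι H : Type*} [NormedAddCommGroup H] (y : lp (fun _ : ι => H) 2) :
    HasSum (fun m => deltaSeq 2 m (y m)) y :=
  letI := Classical.decEq ι
  lp.hasSum_single (by norm_num) y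

theorem inner_deltaSeq_left {ι H : Type*} [NormedAddCommGroup H] [InnerProductSpace ℂ H] (l : ι)
    (f : H) (y : lp (fun _ : ι => H) 2) : inner ℂ (deltaSeq 2 l f) y = inner ℂ f (y l) :=
  letI := Classical.decEq ι
  lp.inner_single_left (𝕜 := ℂ) (G := fun _ : ι => H) l f y

theorem inner_deltaSeq_right {ι H : Type*} [NormedAddCommGroup H] [InnerProductSpace ℂ H] (l : ι)
    (f : H) (y : lp (fun _ : ι => H) 2) : inner ℂ y (deltaSeq 2 l f) = inner ℂ (y l) f :=
  letI := Classical.decEq ι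
  lp.inner_single_right (𝕜 := ℂ) (G := fun _ : ι => H) l f y

/-- Distances `z ≥ 1` and submultiplicative weights `v ≥ 1` of polynomial growth on `ι`, with
exponents `s > r` such that the row sums of `z ^ (-r)` are bounded by `K`. -/
structure OffDiagWeight (ι : Type*) where
  z : ι → ι → ℝ
  v : ι → ι → ℝ
  s : ℝ
  r : ℝ
  a : ℝ
  K : ℝ
  r_nonneg : 0 ≤ r
  r_lt_s : r < s
  a_nonneg : 0 ≤ a
  K_pos : 0 < K
  one_le_z : ∀ k l, 1 ≤ z k l
  one_le_v : ∀ k l, 1 ≤ v k l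
  z_comm : ∀ k l, z k l = z l k
  v_comm : ∀ k l, v k l = v l k
  z_self : ∀ k, z k k = 1
  v_self : ∀ k, v k k = 1
  z_triangle : ∀ k m l, z k l ≤ z k m + z m l
  v_submul : ∀ k m l, v k l ≤ v k m * v m l
  v_le : ∀ k l, v k l ≤ z k l ^ a
  sum_le : ∀ (k : ι) (F : Finset ι), ∑ m ∈ F, z k m ^ (-r) ≤ K

namespace OffDiagWeight

variable {ι : Type*} {H : Type*} [NormedAddCommGroup H] [InnerProductSpace ℂ H]

/-- The off-diagonal decay profile `z ^ (-s) / v`. -/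
def w (W : OffDiagWeight ι) (k l : ι) : ℝ := W.z k l ^ (-W.s) * (W.v k l)⁻¹

/-- The matrix entries of `R` are bounded by `M` times the decay profile of `W`. -/
def Decays (W : OffDiagWeight ι) (R : lp (fun _ : ι => H) 2 →L[ℂ] lp (fun _ : ι => H) 2)
    (M : ℝ) : Prop :=
  ∀ k l f, ‖R (deltaSeq 2 l f) k‖ ≤ M * W.w k l * ‖f‖

/-- The matrix entries of `R`, weighted by `v`, are bounded by `P * z ^ (-r)`. -/
def MomentBound (W : OffDiagWeight ι) (R : lp (fun _ : ι => H) 2 →L[ℂ] lp (fun _ : ι => H) 2)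
    (P : ℝ) : Prop :=
  ∀ k l f, ‖R (deltaSeq 2 l f) k‖ ≤ P * (W.z k l ^ (-W.r) * (W.v k l)⁻¹) * ‖f‖

variable {W : OffDiagWeight ι} {R S : lp (fun _ : ι => H) 2 →L[ℂ] lp (fun _ : ι => H) 2}
  {M M' P P' : ℝ}

theorem z_pos (k l : ι) : 0 < W.z k l := zero_lt_one.trans_le (W.one_le_z k l)

theorem v_pos (k l : ι) : 0 < W.v k l := zero_lt_one.trans_le (W.one_le_v k l)

theorem w_pos (k l : ι) : 0 < W.w k l :=
  mul_pos (Real.rpow_pos_of_pos (z_pos k l) _) (inv_pos.2 (v_pos k l))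

theorem w_comm (k l : ι) : W.w k l = W.w l k := by
  rw [w, w, W.z_comm, W.v_comm]

theorem s_pos : 0 < W.s := W.r_nonneg.trans_lt W.r_lt_s

theorem norm_entry_comp_le {k l : ι} {f : H} {c : ι → ℝ} {B : ℝ}
    (h : ∀ m, ‖R (deltaSeq 2 m (S (deltaSeq 2 l f) m)) k‖ ≤ c m)
    (hc : ∀ F : Finset ι, ∑ m ∈ F, c m ≤ B) :
    ‖(R * S) (deltaSeq 2 l f) k‖ ≤ B := by
  have h1 := (hasSum_deltaSeq (S (deltaSeq 2 l f))).mapL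
    ((lp.evalCLM ℂ (fun _ : ι => H) 2 k).comp R)
  refine le_of_tendsto (Filter.Tendsto.norm h1) (Filter.Eventually.of_forall fun F => ?_)
  exact (norm_sum_le_of_le F fun m _ => h m).trans (hc F)

theorem Decays.mono (h : W.Decays R M) (hM : M ≤ M') : W.Decays R M' := fun k l f =>
  (h k l f).trans <| by have := w_pos (W := W) k l; gcongr

theorem Decays.add (hR : W.Decays R M) (hS : W.Decays S M') : W.Decays (R + S) (M + M') :=
  fun k l f => by
    have : (R + S) (deltaSeq 2 l f) k = R (deltaSeq 2 l f) k + S (deltaSeq 2 l f) k := rfl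
    rw [this]
    refine (norm_add_le _ _).trans ?_
    linarith [hR k l f, hS k l f]

theorem Decays.smul (hR : W.Decays R M) (c : ℂ) : W.Decays (c • R) (‖c‖ * M) := fun k l f => by
  have : (c • R) (deltaSeq 2 l f) k = c • R (deltaSeq 2 l f) k := rfl
  rw [this, norm_smul]
  calc ‖c‖ * ‖R (deltaSeq 2 l f) k‖ ≤ ‖c‖ * (M * W.w k l * ‖f‖) := by
        gcongr; exact hR k l f
    _ = _ := by ring

theorem decays_one : W.Decays (1 : lp (fun _ : ι => H) 2 →L[ℂ] lp (fun _ : ι => H) 2) 1 :=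
  fun k l f => by
    rw [one_apply_eq_self]
    by_cases hkl : k = l
    · subst hkl
      refine (lp.norm_apply_le_norm (by norm_num) _ _).trans ?_
      rw [norm_deltaSeq, w, W.z_self, W.v_self]
      simp
    · rw [deltaSeq_apply_ne f hkl, norm_zero]
      have := w_pos (W := W) k l
      positivity

theorem Decays.adjoint [CompleteSpace H] (hR : W.Decays R M) (hM : 0 ≤ M) :
    W.Decays (ContinuousLinearMap.adjoint R) M := fun k l f => by
  set g := ContinuousLinearMap.adjoint R (deltaSeq 2 l f) k with hg
  have h1 : inner ℂ g g = inner ℂ f (R (deltaSeq 2 k g) l) := by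
    calc inner ℂ g g
        = inner ℂ (ContinuousLinearMap.adjoint R (deltaSeq 2 l f)) (deltaSeq 2 k g) :=
          (inner_deltaSeq_right k g _).symm
      _ = inner ℂ (deltaSeq 2 l f) (R (deltaSeq 2 k g)) :=
          ContinuousLinearMap.adjoint_inner_left _ _ _
      _ = _ := inner_deltaSeq_left l f _
  have h2 : ‖g‖ * ‖g‖ ≤ (M * W.w k l * ‖f‖) * ‖g‖ := by
    calc ‖g‖ * ‖g‖ = ‖inner ℂ g g‖ := by
          rw [inner_self_eq_norm_sq_to_K]; simp [sq]
      _ ≤ ‖f‖ * ‖R (deltaSeq 2 k g) l‖ := h1 ▸ norm_inner_le_norm _ _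
      _ ≤ ‖f‖ * (M * W.w l k * ‖g‖) := by gcongr; exact hR l k g
      _ = _ := by rw [w_comm l k]; ring
  rcases (norm_nonneg g).eq_or_lt with h0 | h0
  · rw [← h0]
    have := w_pos (W := W) k l
    positivity
  · exact le_of_mul_le_mul_right h2 h0

theorem Decays.momentBound (hR : W.Decays R M) (hM : 0 ≤ M) : W.MomentBound R M :=
  fun k l f => (hR k l f).trans <| by
    have := v_pos (W := W) k l
    rw [w]
    gcongr
    · exact W.one_le_z k l
    · exact W.r_lt_s.le

theorem Decays.momentBound_of_norm_le (hR : W.Decays R M) (hM : 0 ≤ M) {ε ρ : ℝ} (hε : ‖R‖ ≤ ε)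
    (hρ : 0 < ρ) :
    W.MomentBound R (ρ ^ (W.a + W.r) * ε + ρ ^ (-(W.s - W.r)) * M) := fun k l f => by
  have hv := v_pos (W := W) k l
  have hz := z_pos (W := W) k l
  have hε0 : 0 ≤ ε := (norm_nonneg R).trans hε
  rcases le_total (W.z k l) ρ with h | h
  · have h1 : ‖R (deltaSeq 2 l f) k‖ ≤ ε * ‖f‖ :=
      calc _ ≤ ‖R (deltaSeq 2 l f)‖ := lp.norm_apply_le_norm (by norm_num) _ _
        _ ≤ ‖R‖ * ‖deltaSeq 2 l f‖ := R.le_opNorm _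
        _ ≤ _ := by rw [norm_deltaSeq]; gcongr
    have h2 : 1 ≤ ρ ^ (W.a + W.r) * (W.z k l ^ (-W.r) * (W.v k l)⁻¹) := by
      have h3 : W.v k l ≤ ρ ^ (W.a + W.r) * W.z k l ^ (-W.r) :=
        calc W.v k l ≤ W.z k l ^ W.a := W.v_le k l
          _ = W.z k l ^ (W.a + W.r) * W.z k l ^ (-W.r) := by
            rw [← Real.rpow_add hz]; congr 1; ring
          _ ≤ _ := by
            gcongr
            exact add_nonneg W.a_nonneg W.r_nonneg
      rw [← mul_assoc, ← div_eq_mul_inv, one_le_div hv]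
      exact h3
    calc _ ≤ 1 * (ε * ‖f‖) := by rw [one_mul]; exact h1
      _ ≤ ρ ^ (W.a + W.r) * (W.z k l ^ (-W.r) * (W.v k l)⁻¹) * (ε * ‖f‖) := by gcongr
      _ = (ρ ^ (W.a + W.r) * ε + 0) * (W.z k l ^ (-W.r) * (W.v k l)⁻¹) * ‖f‖ := by ring
      _ ≤ _ := by gcongr; positivity
  · have h1 : W.z k l ^ (-W.s) ≤ ρ ^ (-(W.s - W.r)) * W.z k l ^ (-W.r) :=
      calc W.z k l ^ (-W.s) = W.z k l ^ (-(W.s - W.r)) * W.z k l ^ (-W.r) := by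
            rw [← Real.rpow_add hz]; congr 1; ring
        _ ≤ _ := by
          gcongr ?_ * _
          exact Real.rpow_le_rpow_of_nonpos hρ h (by linarith [W.r_lt_s])
    calc _ ≤ M * (W.z k l ^ (-W.s) * (W.v k l)⁻¹) * ‖f‖ := hR k l f
      _ ≤ M * (ρ ^ (-(W.s - W.r)) * W.z k l ^ (-W.r) * (W.v k l)⁻¹) * ‖f‖ := by gcongr
      _ = (0 + ρ ^ (-(W.s - W.r)) * M) * (W.z k l ^ (-W.r) * (W.v k l)⁻¹) * ‖f‖ := by ring
      _ ≤ _ := by gcongr; positivity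

theorem z_rpow_le {k l m n : ι} (h : W.z k l / 2 ≤ W.z m n) :
    W.z m n ^ (-W.s) ≤ 2 ^ W.s * W.z k l ^ (-W.s) := by
  have hz := z_pos (W := W) k l
  calc W.z m n ^ (-W.s) ≤ (W.z k l / 2) ^ (-W.s) :=
        Real.rpow_le_rpow_of_nonpos (by positivity) h (by linarith [s_pos (W := W)])
    _ = _ := by
      rw [Real.div_rpow hz.le (by norm_num), Real.rpow_neg (by norm_num : (0 : ℝ) ≤ 2),
        div_inv_eq_mul, mul_comm]

theorem v_inv_mul_le (k m l : ι) : (W.v k m)⁻¹ * (W.v m l)⁻¹ ≤ (W.v k l)⁻¹ := by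
  rw [← mul_inv]
  exact inv_anti₀ (v_pos k l) (W.v_submul k m l)

theorem Decays.mul_of_momentBound (hR : W.Decays R M) (hR' : W.MomentBound R P)
    (hS : W.Decays S M') (hS' : W.MomentBound S P') (hM : 0 ≤ M) (hP : 0 ≤ P) (hM' : 0 ≤ M')
    (hP' : 0 ≤ P') : W.Decays (R * S) (2 ^ W.s * W.K * (M * P' + P * M')) := fun k l f => by
  have hz : ∀ k l, 0 < W.z k l := z_pos
  have hv : ∀ k l, 0 < W.v k l := v_pos
  have hw := w_pos (W := W) k l
  refine norm_entry_comp_le (c := fun m => 2 ^ W.s * W.w k l * ‖f‖ *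
    (M * P' * W.z l m ^ (-W.r) + P * M' * W.z k m ^ (-W.r))) (fun m => ?_) fun F => ?_
  · have hzr : ∀ k l, 0 < W.z k l ^ (-W.r) := fun k l => Real.rpow_pos_of_pos (hz k l) _
    have hzs : ∀ k l, 0 < W.z k l ^ (-W.s) := fun k l => Real.rpow_pos_of_pos (hz k l) _
    have hv' : ∀ k l, 0 < (W.v k l)⁻¹ := fun k l => inv_pos.2 (hv k l)
    have h1 := hzr l m
    have h2 := hzr k m
    have hvv := v_inv_mul_le (W := W) k m l
    rcases le_total (W.z k l / 2) (W.z k m) with h | h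
    · calc ‖R (deltaSeq 2 m (S (deltaSeq 2 l f) m)) k‖
          ≤ M * W.w k m * ‖S (deltaSeq 2 l f) m‖ := hR _ _ _
        _ ≤ M * W.w k m * (P' * (W.z m l ^ (-W.r) * (W.v m l)⁻¹) * ‖f‖) := by
            have := w_pos (W := W) k m
            gcongr
            exact hS' _ _ _
        _ = M * P' * W.z l m ^ (-W.r) * ‖f‖ *
              (W.z k m ^ (-W.s) * ((W.v k m)⁻¹ * (W.v m l)⁻¹)) := by
            rw [w, W.z_comm m l]; ring
        _ ≤ M * P' * W.z l m ^ (-W.r) * ‖f‖ *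
              ((2 ^ W.s * W.z k l ^ (-W.s)) * (W.v k l)⁻¹) := by
            have := hzs k l
            have := hv' k m
            have := hv' m l
            gcongr
            exact z_rpow_le h
        _ = 2 ^ W.s * W.w k l * ‖f‖ * (M * P' * W.z l m ^ (-W.r) + 0) := by rw [w]; ring
        _ ≤ _ := by gcongr; positivity
    · have h' : W.z k l / 2 ≤ W.z m l := by linarith [W.z_triangle k m l]
      calc ‖R (deltaSeq 2 m (S (deltaSeq 2 l f) m)) k‖
          ≤ P * (W.z k m ^ (-W.r) * (W.v k m)⁻¹) * ‖S (deltaSeq 2 l f) m‖ := hR' _ _ _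
        _ ≤ P * (W.z k m ^ (-W.r) * (W.v k m)⁻¹) * (M' * W.w m l * ‖f‖) := by
            have := hv' k m
            gcongr
            exact hS _ _ _
        _ = P * M' * W.z k m ^ (-W.r) * ‖f‖ *
              (W.z m l ^ (-W.s) * ((W.v k m)⁻¹ * (W.v m l)⁻¹)) := by
            rw [w]; ring
        _ ≤ P * M' * W.z k m ^ (-W.r) * ‖f‖ *
              ((2 ^ W.s * W.z k l ^ (-W.s)) * (W.v k l)⁻¹) := by
            have := hzs k l
            have := hv' k m
            have := hv' m l
            gcongr
            exact z_rpow_le h'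
        _ = 2 ^ W.s * W.w k l * ‖f‖ * (0 + P * M' * W.z k m ^ (-W.r)) := by rw [w]; ring
        _ ≤ _ := by gcongr; positivity
  · rw [← Finset.mul_sum, Finset.sum_add_distrib, ← Finset.mul_sum, ← Finset.mul_sum]
    calc _ ≤ 2 ^ W.s * W.w k l * ‖f‖ * (M * P' * W.K + P * M' * W.K) := by
          gcongr <;> exact W.sum_le _ _
      _ = _ := by ring

/-- The constant for which decay is submultiplicative. -/
def mulConst (W : OffDiagWeight ι) : ℝ := 2 * (2 ^ W.s * W.K)

theorem mulConst_pos : 0 < W.mulConst := by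
  have := W.K_pos
  unfold mulConst
  positivity

theorem Decays.mul (hR : W.Decays R M) (hS : W.Decays S M') (hM : 0 ≤ M) (hM' : 0 ≤ M') :
    W.Decays (R * S) (W.mulConst * M * M') :=
  (hR.mul_of_momentBound (hR.momentBound hM) hS (hS.momentBound hM') hM hM hM' hM').mono
    (by rw [mulConst]; exact le_of_eq (by ring))

/-- Squaring gains from the smallness of the operator norm; `ρ` is the truncation radius. -/
theorem Decays.mul_self (hR : W.Decays R M) (hM : 0 ≤ M) {ε ρ : ℝ} (hε : ‖R‖ ≤ ε) (hρ : 0 < ρ) :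
    W.Decays (R * R)
      (W.mulConst * M * (ρ ^ (W.a + W.r) * ε + ρ ^ (-(W.s - W.r)) * M)) := by
  have hε0 : 0 ≤ ε := (norm_nonneg R).trans hε
  have h := hR.momentBound_of_norm_le hM hε hρ
  exact (hR.mul_of_momentBound h hR h hM (by positivity) hM (by positivity)).mono
    (by rw [mulConst]; exact le_of_eq (by ring))

/-- Repeated squaring costs only a factor subexponential in `2 ^ k` over the norm. -/
theorem Decays.exists_pow_two_pow (hR : W.Decays R M) {q : ℝ} (hq : 0 < q) (hRq : ‖R‖ ≤ q)
    (hM : 0 ≤ M) :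
    ∃ B t : ℝ, 0 < t ∧ t < 2 ∧
      ∀ k : ℕ, W.Decays (R ^ 2 ^ k) (q ^ 2 ^ k * Real.exp (B * t ^ k)) := by
  have hK := mulConst_pos (W := W)
  set a := W.a + W.r with ha
  set b := W.s - W.r with hb
  have ha0 : 0 ≤ a := add_nonneg W.a_nonneg W.r_nonneg
  have hb0 : 0 < b := sub_pos.2 W.r_lt_s
  set η := 1 / (2 * (a + 1)) with hη
  have hη0 : 0 < η := by positivity
  have haη : 1 + a * η ≤ 3 / 2 := by
    have : a * η ≤ 1 / 2 := by
      rw [hη, mul_one_div, div_le_div_iff₀ (by positivity) (by norm_num)]; linarith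
    linarith
  set t₀ := max (3 / 2) (2 - b * η) with ht₀
  have ht₀2 : t₀ < 2 := max_lt (by norm_num) (by linarith [mul_pos hb0 hη0])
  have ht₀1 : 3 / 2 ≤ t₀ := le_max_left _ _
  set t := (t₀ + 2) / 2 with ht
  have htt : 0 < t - t₀ := by linarith
  have ht1 : 1 ≤ t := by linarith
  set B := M / q + 2 * W.mulConst / (t - t₀) with hB
  have hB0 : 0 < B := by positivity
  refine ⟨B, t, by linarith, by linarith, fun k => ?_⟩
  induction k with
  | zero =>
    simp only [pow_zero, pow_one, mul_one]
    refine hR.mono ?_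
    have h1 : M / q ≤ B := le_add_of_nonneg_right (by positivity)
    have h2 : M / q ≤ Real.exp B := h1.trans (by linarith [Real.add_one_le_exp B])
    rwa [div_le_iff₀ hq, mul_comm] at h2
  | succ k ih =>
    set e := t ^ k with he
    have he1 : 1 ≤ e := one_le_pow₀ ht1
    set Q := q ^ 2 ^ k with hQ
    have hQ0 : 0 < Q := by positivity
    have hn : ‖R ^ 2 ^ k‖ ≤ Q :=
      (norm_pow_le' R (by positivity)).trans (by rw [hQ]; gcongr)
    have h := ih.mul_self (by positivity) hn (Real.exp_pos (B * η * e))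
    rw [pow_succ 2 k, pow_mul R, sq, pow_mul q, ← hQ]
    refine h.mono ?_
    rw [← ha, ← hb, ← Real.exp_mul, ← Real.exp_mul]
    have h1 : Real.exp (B * e) * Real.exp (B * η * e * a) ≤ Real.exp (B * t₀ * e) := by
      rw [← Real.exp_add]
      refine Real.exp_le_exp.2 ?_
      calc B * e + B * η * e * a = B * e * (1 + a * η) := by ring
        _ ≤ B * e * t₀ := by gcongr; exact haη.trans ht₀1
        _ = _ := by ring
    have h2 : Real.exp (B * e) * (Real.exp (B * η * e * -b) * Real.exp (B * e))
        ≤ Real.exp (B * t₀ * e) := by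
      rw [← Real.exp_add, ← Real.exp_add]
      refine Real.exp_le_exp.2 ?_
      calc B * e + (B * η * e * -b + B * e) = B * e * (2 - b * η) := by ring
        _ ≤ B * e * t₀ := by gcongr; exact le_max_right _ _
        _ = _ := by ring
    have h3 : 2 * W.mulConst ≤ Real.exp (B * (t - t₀) * e) := by
      have h4 : 2 * W.mulConst ≤ B * (t - t₀) := by
        rw [← div_le_iff₀ htt]
        exact le_add_of_nonneg_left (by positivity)
      have h5 : B * (t - t₀) ≤ B * (t - t₀) * e := le_mul_of_one_le_right (by positivity) he1
      linarith [Real.add_one_le_exp (B * (t - t₀) * e)]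
    calc W.mulConst * (Q * Real.exp (B * e)) *
          (Real.exp (B * η * e * a) * Q + Real.exp (B * η * e * -b) * (Q * Real.exp (B * e)))
        = W.mulConst * Q ^ 2 * (Real.exp (B * e) * Real.exp (B * η * e * a) +
            Real.exp (B * e) * (Real.exp (B * η * e * -b) * Real.exp (B * e))) := by ring
      _ ≤ W.mulConst * Q ^ 2 * (Real.exp (B * t₀ * e) + Real.exp (B * t₀ * e)) := by gcongr
      _ = Q ^ 2 * (2 * W.mulConst * Real.exp (B * t₀ * e)) := by ring
      _ ≤ Q ^ 2 * (Real.exp (B * (t - t₀) * e) * Real.exp (B * t₀ * e)) := by gcongr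
      _ = Q ^ 2 * Real.exp (B * t ^ (k + 1)) := by
        rw [← Real.exp_add, pow_succ t k, ← he]; ring_nf

theorem Decays.exists_pow_lt (hR : W.Decays R M) {q : ℝ} (hq : 0 < q) (hq1 : q < 1)
    (hRq : ‖R‖ ≤ q) (hM : 0 ≤ M) {ε : ℝ} (hε : 0 < ε) :
    ∃ n : ℕ, 0 < n ∧ W.Decays (R ^ n) ε := by
  obtain ⟨B, t, ht, ht2, h⟩ := hR.exists_pow_two_pow hq hRq hM
  have h1 : Filter.Tendsto (fun k : ℕ => Real.log q + B * (t / 2) ^ k) Filter.atTop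
      (nhds (Real.log q + B * 0)) :=
    ((tendsto_pow_atTop_nhds_zero_of_lt_one (by positivity) (by linarith)).const_mul B).const_add _
  rw [mul_zero, add_zero] at h1
  have h2 := (tendsto_pow_atTop_atTop_of_one_lt (one_lt_two (α := ℝ))).atTop_mul_neg
    (Real.log_neg hq hq1) h1
  obtain ⟨k, hk⟩ := ((Real.tendsto_exp_atBot.comp h2).eventually (ge_mem_nhds hε)).exists
  refine ⟨2 ^ k, by positivity, (h k).mono (le_trans (le_of_eq ?_) hk)⟩
  have h3 : q ^ 2 ^ k = Real.exp (2 ^ k * Real.log q) := by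
    rw [mul_comm, Real.exp_mul, Real.exp_log hq]
    norm_cast
  rw [h3, ← Real.exp_add, Function.comp]
  congr 1
  rw [mul_add, div_pow]
  field_simp

/-- Solutions of `S = R S + Y` with `‖R‖ < 1` inherit the decay of `R` and `Y`. -/
theorem exists_decays_of_eq_mul_add {Y : lp (fun _ : ι => H) 2 →L[ℂ] lp (fun _ : ι => H) 2}
    (hR : W.Decays R M) (hM : 0 ≤ M) (hY : W.Decays Y P) (hP : 0 ≤ P) {q : ℝ} (hq : 0 < q)
    (hq1 : q < 1) (hRq : ‖R‖ ≤ q) (hS : S = R * S + Y) :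
    ∃ C : ℝ, 0 < C ∧ W.Decays S C := by
  have hK := mulConst_pos (W := W)
  have iter : ∀ n : ℕ, ∃ Y' P', 0 ≤ P' ∧ W.Decays Y' P' ∧ S = R ^ n * S + Y' := fun n => by
    induction n with
    | zero =>
      exact ⟨Y + (-1 : ℂ) • Y, P + ‖(-1 : ℂ)‖ * P, by positivity, hY.add (hY.smul _), by simp⟩
    | succ n ih =>
      obtain ⟨Y', P', hP', hY', h⟩ := ih
      refine ⟨R * Y' + Y, _, ?_, (hR.mul hY' hM hP').add hY, ?_⟩
      · positivity
      · rw [pow_succ', mul_assoc, ← add_assoc, ← mul_add, ← h, ← hS]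
  obtain ⟨n, hn0, hn⟩ := hR.exists_pow_lt hq hq1 hRq hM (ε := 1 / (2 * W.mulConst)) (by positivity)
  obtain ⟨Y', P', hP', hY', h⟩ := iter n
  have iter' : ∀ j : ℕ, ∃ Z, W.Decays Z (2 * P') ∧ S = (R ^ n) ^ (j + 1) * S + Z := fun j => by
    induction j with
    | zero => exact ⟨Y', hY'.mono (by linarith), by simpa using h⟩
    | succ j ih =>
      obtain ⟨Z, hZ, hj⟩ := ih
      refine ⟨R ^ n * Z + Y', ((hn.mul hZ (by positivity) (by positivity)).add hY').mono ?_, ?_⟩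
      · field_simp; linarith
      · rw [pow_succ', mul_assoc, ← add_assoc, ← mul_add, ← hj, ← h]
  refine ⟨2 * P' + 1, by positivity, Decays.mono (M := 2 * P') (fun k l f => ?_) (by linarith)⟩
  have hlim : Filter.Tendsto (fun j : ℕ => q ^ (j + 1) * (‖S‖ * ‖f‖) + 2 * P' * W.w k l * ‖f‖)
      Filter.atTop (nhds (0 * (‖S‖ * ‖f‖) + 2 * P' * W.w k l * ‖f‖)) :=
    (((Filter.tendsto_add_atTop_iff_nat 1).2
      (tendsto_pow_atTop_nhds_zero_of_lt_one hq.le hq1)).mul_const _).add_const _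
  rw [zero_mul, zero_add] at hlim
  refine ge_of_tendsto hlim (Filter.Eventually.of_forall fun j => ?_)
  obtain ⟨Z, hZ, hj⟩ := iter' j
  have h1 : S (deltaSeq 2 l f) k = ((R ^ n) ^ (j + 1)) (S (deltaSeq 2 l f)) k
      + Z (deltaSeq 2 l f) k := by
    conv_lhs => rw [hj]
    rfl
  have h2 : ‖(R ^ n) ^ (j + 1)‖ ≤ q ^ (j + 1) := by
    rw [← pow_mul]
    calc ‖R ^ (n * (j + 1))‖ ≤ ‖R‖ ^ (n * (j + 1)) := norm_pow_le' R (by positivity)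
      _ ≤ q ^ (n * (j + 1)) := by gcongr
      _ ≤ q ^ (j + 1) := pow_le_pow_of_le_one hq.le hq1.le (Nat.le_mul_of_pos_left _ hn0)
  rw [h1]
  refine (norm_add_le _ _).trans (add_le_add ?_ (hZ k l f))
  calc _ ≤ ‖((R ^ n) ^ (j + 1)) (S (deltaSeq 2 l f))‖ := lp.norm_apply_le_norm (by norm_num) _ _
    _ ≤ ‖(R ^ n) ^ (j + 1)‖ * (‖S‖ * ‖deltaSeq 2 l f‖) :=
      ContinuousLinearMap.le_opNorm_of_le _ (S.le_opNorm _)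
    _ ≤ _ := by rw [norm_deltaSeq]; gcongr

end OffDiagWeight

/-- The anisotropic polynomial weight on a relatively separated set. -/
theorem exists_offDiagWeight {d : ℕ} (X : Set (Euc d)) (hX : RelSep X) (s : ℝ)
    (hs : (d : ℝ) < s) (α : Fin d → ℕ) :
    ∃ W : OffDiagWeight X, ∀ k l, W.w k l = (1 + ‖(k : Euc d) - (l : Euc d)‖) ^ (-s) *
      ∏ j : Fin d, ((1 + |(k : Euc d) j - (l : Euc d) j|) ^ (α j) : ℝ)⁻¹ := by
  obtain ⟨K, hK, hsum⟩ := exists_sum_one_add_norm_sub_rpow_le X hX ((d + s) / 2) (by linarith)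
  have hd : (0 : ℝ) ≤ d := Nat.cast_nonneg d
  have hle : ∀ (x : Euc d) (j : Fin d), |x j| ≤ ‖x‖ := fun x j => PiLp.norm_apply_le x j
  refine ⟨{
    z := fun k l => 1 + ‖(k : Euc d) - (l : Euc d)‖
    v := fun k l => ∏ j : Fin d, (1 + |(k : Euc d) j - (l : Euc d) j|) ^ (α j)
    s := s
    r := (d + s) / 2
    a := ((∑ j, α j : ℕ) : ℝ)
    K := K
    r_nonneg := by linarith
    r_lt_s := by linarith
    a_nonneg := Nat.cast_nonneg _
    K_pos := hK
    one_le_z := fun k l => le_add_of_nonneg_right (norm_nonneg _)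
    one_le_v := fun k l => ?_
    z_comm := fun k l => by rw [norm_sub_rev]
    v_comm := fun k l => by simp only [abs_sub_comm]
    z_self := fun k => by simp
    v_self := fun k => by simp
    z_triangle := fun k m l => ?_
    v_submul := fun k m l => ?_
    v_le := fun k l => ?_
    sum_le := hsum }, fun k l => ?_⟩
  · exact Finset.one_le_prod fun j _ => one_le_pow₀ (le_add_of_nonneg_right (abs_nonneg _))
  · linarith [norm_sub_le_norm_sub_add_norm_sub (k : Euc d) m l]
  · rw [← Finset.prod_mul_distrib]
    refine Finset.prod_le_prod (fun j _ => by positivity) fun j _ => ?_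
    rw [← mul_pow]
    gcongr
    have h1 := abs_sub_le ((k : Euc d) j) ((m : Euc d) j) ((l : Euc d) j)
    have h2 := mul_nonneg (abs_nonneg ((k : Euc d) j - (m : Euc d) j))
      (abs_nonneg ((m : Euc d) j - (l : Euc d) j))
    nlinarith
  · rw [Real.rpow_natCast, ← Finset.prod_pow_eq_pow_sum]
    refine Finset.prod_le_prod (fun j _ => by positivity) fun j _ => ?_
    gcongr
    exact hle ((k : Euc d) - l) j
  · rw [OffDiagWeight.w, Finset.prod_inv_distrib]

theorem statement18 {d : ℕ} (X : Set (Euc d)) (hX : RelSep X)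
    (H : Type*) [NormedAddCommGroup H] [InnerProductSpace ℂ H] [CompleteSpace H]
    [TopologicalSpace.SeparableSpace H]
    (s : ℝ) (hs : (d : ℝ) < s) (α : Fin d → ℕ)
    (A : ↥X → ↥X → (H →L[ℂ] H))
    (C : ℝ) (hC : 0 < C)
    (hA : ∀ k l : ↥X, ‖A k l‖ ≤
      C * (1 + ‖(k : Euc d) - (l : Euc d)‖) ^ (-s) *
        ∏ j : Fin d, ((1 + |(k : Euc d) j - (l : Euc d) j|) ^ (α j) : ℝ)⁻¹)
    (T : lp (fun _ : ↥X => H) 2 →L[ℂ] lp (fun _ : ↥X => H) 2)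
    (hT : ∀ (f : lp (fun _ : ↥X => H) 2) (k : ↥X), T f k = ∑' l : ↥X, A k l (f l))
    (S : lp (fun _ : ↥X => H) 2 →L[ℂ] lp (fun _ : ↥X => H) 2)
    (hST : S.comp T = ContinuousLinearMap.id ℂ _)
    (hTS : T.comp S = ContinuousLinearMap.id ℂ _) :
    ∃ C' > 0, ∀ (k l : ↥X) (f : H),
      ‖(S (deltaSeq 2 l f)) k‖ ≤
        C' * (1 + ‖(k : Euc d) - (l : Euc d)‖) ^ (-s) *
          (∏ j : Fin d, ((1 + |(k : Euc d) j - (l : Euc d) j|) ^ (α j) : ℝ)⁻¹) * ‖f‖ := by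
  obtain ⟨W, hW⟩ := exists_offDiagWeight X hX s hs α
  have hTdec : W.Decays T C := fun k l f => by
    have h : T (deltaSeq 2 l f) k = A k l f := by
      rw [hT, tsum_eq_single l fun m hm => by rw [deltaSeq_apply_ne f hm, map_zero],
        deltaSeq_apply_self]
    rw [h, hW, ← mul_assoc]
    exact (A k l).le_of_opNorm_le (hA k l) f
  obtain ⟨c, q, hq, hq1, hR⟩ := exists_norm_id_sub_smul_adjoint_comp_le T S hST
  have hTadj := hTdec.adjoint hC.le
  have hRdec := OffDiagWeight.decays_one.add
    ((hTadj.mul hTdec hC.le hC.le).smul (-(c : ℂ)))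
  have hK := OffDiagWeight.mulConst_pos (W := W)
  have hReq : ContinuousLinearMap.id ℂ _ - (c : ℂ) • (ContinuousLinearMap.adjoint T).comp T
      = 1 + (-(c : ℂ)) • (ContinuousLinearMap.adjoint T * T) := by
    rw [neg_smul, ← sub_eq_add_neg]
    rfl
  rw [hReq] at hR
  have hTS' : T * S = 1 := hTS
  obtain ⟨C', hC', hS⟩ := OffDiagWeight.exists_decays_of_eq_mul_add (S := S) hRdec
    (by positivity) (hTadj.smul (c : ℂ)) (by positivity) hq hq1 hR
    (by rw [add_mul, one_mul, smul_mul_assoc, mul_assoc, hTS', mul_one]; simp)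
  refine ⟨C', hC', fun k l f => ?_⟩
  rw [mul_assoc C', ← hW]
  exact hS k l f
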